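/- arXiv:1409.7059 — 3 statements merged into one kernel-verified Lean document; each statement's English description precedes it below -/
import Mathlib

section
/- Let H, J ∈ ℂ[x,y] be homogeneous polynomials with H nonconstant, let s = s(H) and let G be a simple homogeneous polynomial with G^s = H. Then D(H,J) = 0 if and only if there exist λ ∈ ℂ and t ∈ ℤ such that, in the fraction field of ℂ[x,y], J = λ·G^t. -/
open MvPolynomial

/-- The Jacobian determinant `D(F,G) = F_x G_y - F_y G_x` of two polynomials in two
variables, using formal partial derivatives. -/
noncomputable def jacDet (F G : MvPolynomial (Fin 2) ℂ) : MvPolynomial (Fin 2) ℂ :=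
  pderiv 0 F * pderiv 1 G - pderiv 1 F * pderiv 0 G

/-- For an element `R` of the fraction field of `ℂ[x,y]`,
`sVal R = sup {m ≥ 1 | R = X^m for some X in the fraction field}`. -/
noncomputable def sVal (R : FractionRing (MvPolynomial (Fin 2) ℂ)) : ℕ :=
  sSup {m : ℕ | 1 ≤ m ∧ ∃ X : FractionRing (MvPolynomial (Fin 2) ℂ), R = X ^ m}

open scoped MonomialOrder

section Coefficients

variable {σ R : Type*} [CommSemiring R]

lemma MvPolynomial.coeff_X_mul_pderiv (i : σ) (f : MvPolynomial σ R) (d : σ →₀ ℕ) :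
    (X i * pderiv i f).coeff d = d i * f.coeff d := by
  induction f using MvPolynomial.induction_on' with
  | monomial u a =>
    classical
    rw [X_mul_pderiv_monomial, coeff_smul, coeff_monomial]
    split_ifs with h <;> simp [h]
  | add p q hp hq => simp only [map_add, mul_add, coeff_add, hp, hq]

lemma MonomialOrder.degree_X_mul_pderiv_le (m : MonomialOrder σ) (i : σ)
    (f : MvPolynomial σ R) : m.degree (X i * pderiv i f) ≼[m] m.degree f := by
  rw [m.degree_le_iff]
  intro c hc
  refine m.le_degree (mem_support_iff.2 fun h => mem_support_iff.1 hc ?_)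
  rw [coeff_X_mul_pderiv, h, mul_zero]

end Coefficients

/-- Two nonzero polynomials with the same logarithmic derivatives have the same leading
monomial. -/
lemma MonomialOrder.degree_eq_of_pderiv_mul_eq {σ K : Type*} [CommRing K] [IsDomain K]
    [CharZero K] (m : MonomialOrder σ) {P Q : MvPolynomial σ K} (hP : P ≠ 0) (hQ : Q ≠ 0)
    (h : ∀ i, pderiv i P * Q = P * pderiv i Q) : m.degree P = m.degree Q := by
  ext i
  have h' : (X i * pderiv i P) * Q = P * (X i * pderiv i Q) := by
    linear_combination X i * h i
  have hc := congrArg (coeff (m.degree P + m.degree Q)) h'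
  rw [m.coeff_mul_of_add_of_degree_le (m.degree_X_mul_pderiv_le i P) le_rfl,
    m.coeff_mul_of_add_of_degree_le le_rfl (m.degree_X_mul_pderiv_le i Q),
    coeff_X_mul_pderiv, coeff_X_mul_pderiv] at hc
  have hP' := m.coeff_degree_ne_zero_iff.2 hP
  have hQ' := m.coeff_degree_ne_zero_iff.2 hQ
  have : ((m.degree P i : K) - m.degree Q i) *
      (coeff (m.degree P) P * coeff (m.degree Q) Q) = 0 := by linear_combination hc
  have := (mul_eq_zero.1 this).resolve_right (mul_ne_zero hP' hQ')
  exact_mod_cast sub_eq_zero.1 this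

/-- Polynomials with the same logarithmic derivatives are proportional. -/
lemma MvPolynomial.exists_eq_C_mul_of_pderiv_mul_eq {σ K : Type*} [Field K] [CharZero K]
    {P Q : MvPolynomial σ K} (hQ : Q ≠ 0)
    (h : ∀ i, pderiv i P * Q = P * pderiv i Q) : ∃ c : K, P = C c * Q := by
  obtain ⟨_, _⟩ := exists_wellFoundedGT σ
  let m : MonomialOrder σ := MonomialOrder.lex
  have hQ' := m.coeff_degree_ne_zero_iff.2 hQ
  refine ⟨P.coeff (m.degree Q) / Q.coeff (m.degree Q), ?_⟩
  set c := P.coeff (m.degree Q) / Q.coeff (m.degree Q) with hc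
  by_contra hne
  have hR : P - C c * Q ≠ 0 := sub_ne_zero.2 hne
  have hdeg : m.degree (P - C c * Q) = m.degree Q := by
    refine m.degree_eq_of_pderiv_mul_eq hR hQ fun i => ?_
    rw [map_sub, pderiv_C_mul]
    linear_combination h i
  apply m.coeff_degree_ne_zero_iff.2 hR
  rw [hdeg, coeff_sub, coeff_C_mul, hc, div_mul_cancel₀ _ hQ', sub_self]

/-- An algebraically closed field is closed under roots taken in an extension field. -/
lemma IsAlgClosed.exists_algebraMap_eq_of_pow_eq {K L : Type*} [Field K] [IsAlgClosed K]
    [Field L] [Algebra K L] {z : L} {d : ℕ} (hd : 0 < d) {c : K}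
    (hz : z ^ d = algebraMap K L c) : ∃ e : K, algebraMap K L e = z := by
  have hint : IsIntegral K z := IsIntegral.of_pow hd (hz ▸ isIntegral_algebraMap)
  exact minpoly.mem_range_of_degree_eq_one K z
    (IsAlgClosed.degree_eq_one_of_irreducible K (minpoly.irreducible hint))

/-- Over an algebraically closed field, if `x ^ g = c * y ^ l` and `y` is not a proper power,
then `x` is a constant multiple of a power of `y`. -/
lemma IsAlgClosed.exists_eq_algebraMap_mul_pow {K L : Type*} [Field K] [IsAlgClosed K]
    [Field L] [Algebra K L] {x y : L} (hx : x ≠ 0) (hy : y ≠ 0)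
    (hsimple : ∀ m : ℕ, 1 ≤ m → ∀ X : L, y = X ^ m → m = 1) {g l : ℕ} (hg : 0 < g) {c : K}
    (h : x ^ g = algebraMap K L c * y ^ l) :
    ∃ (e : K) (t : ℕ), x = algebraMap K L e * y ^ t := by
  obtain ⟨d, a, b, hd, hab, rfl, rfl⟩ := Nat.exists_coprime' (m := g) (n := l)
    (Nat.gcd_pos_of_pos_left _ hg)
  have ha : 0 < a := Nat.pos_of_mul_pos_right hg
  obtain ⟨e, he⟩ := IsAlgClosed.exists_algebraMap_eq_of_pow_eq (z := x ^ a / y ^ b) hd (c := c)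
    (by rw [div_pow, ← pow_mul, ← pow_mul, h]; field_simp)
  have hxy : x ^ a = algebraMap K L e * y ^ b := by rw [he]; field_simp
  obtain ⟨r, hr⟩ := IsAlgClosed.exists_pow_nat_eq e ha
  have hr0 : algebraMap K L r ≠ 0 := by
    intro h0
    rw [← hr, map_pow, h0, zero_pow ha.ne', zero_mul] at hxy
    exact pow_ne_zero _ hx hxy
  have hyb : y ^ b = (x / algebraMap K L r) ^ a := by
    rw [div_pow, hxy, ← hr, map_pow]
    field_simp
  have hbez : (1 : ℤ) = a * a.gcdA b + b * a.gcdB b := by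
    rw [← Nat.gcd_eq_gcd_ab, hab.gcd_eq_one, Nat.cast_one]
  have hpow : y = (y ^ a.gcdA b * (x / algebraMap K L r) ^ a.gcdB b) ^ a := by
    calc y = y ^ (1 : ℤ) := (zpow_one y).symm
      _ = (y ^ a.gcdA b) ^ a * (y ^ b) ^ a.gcdB b := by
        rw [hbez, zpow_add₀ hy, mul_comm (a : ℤ), zpow_mul, zpow_mul, zpow_natCast, zpow_natCast]
      _ = _ := by
        rw [hyb, mul_pow, ← zpow_natCast ((x / algebraMap K L r) ^ a.gcdB b), ← zpow_mul,
          ← zpow_natCast (x / algebraMap K L r), ← zpow_mul, mul_comm (a : ℤ) (a.gcdB b)]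
  obtain rfl := hsimple a ha _ hpow
  exact ⟨e, b, by rw [← hxy, pow_one]⟩

lemma jacDet_pow_left (F J : MvPolynomial (Fin 2) ℂ) (n : ℕ) :
    jacDet (F ^ n) J = n * F ^ (n - 1) * jacDet F J := by
  simp only [jacDet, pderiv_pow]
  ring

lemma jacDet_pow_right_self (F : MvPolynomial (Fin 2) ℂ) (n : ℕ) : jacDet F (F ^ n) = 0 := by
  simp only [jacDet, pderiv_pow]
  ring

lemma jacDet_mul_right (F J K : MvPolynomial (Fin 2) ℂ) :
    jacDet F (J * K) = jacDet F J * K + J * jacDet F K := by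
  simp only [jacDet, pderiv_mul]
  ring

lemma jacDet_C_right (F : MvPolynomial (Fin 2) ℂ) (c : ℂ) : jacDet F (C c) = 0 := by
  simp [jacDet]

lemma jacDet_pow_left_eq_zero_iff {F J : MvPolynomial (Fin 2) ℂ} (hF : F ≠ 0) {n : ℕ}
    (hn : n ≠ 0) : jacDet (F ^ n) J = 0 ↔ jacDet F J = 0 := by
  rw [jacDet_pow_left, mul_eq_zero_iff_left]
  exact mul_ne_zero (Nat.cast_ne_zero.2 hn) (pow_ne_zero _ hF)

/-- Homogeneous polynomials in two variables with vanishing Jacobian determinant have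
proportional logarithmic derivatives, with ratio given by their degrees. -/
lemma pderiv_mul_eq_of_jacDet_eq_zero {G J : MvPolynomial (Fin 2) ℂ} {g l : ℕ}
    (hG : G.IsHomogeneous g) (hJ : J.IsHomogeneous l) (h : jacDet G J = 0) (i : Fin 2) :
    (g : MvPolynomial (Fin 2) ℂ) * G * pderiv i J = l * J * pderiv i G := by
  have eG := hG.sum_X_mul_pderiv
  have eJ := hJ.sum_X_mul_pderiv
  simp only [Fin.sum_univ_two, nsmul_eq_mul] at eG eJ
  rw [jacDet] at h
  fin_cases i
  · simp only [Fin.zero_eta]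
    linear_combination pderiv 0 G * eJ - pderiv 0 J * eG - X 1 * h
  · simp only [Fin.mk_one]
    linear_combination pderiv 1 G * eJ - pderiv 1 J * eG + X 0 * h

/-- Homogeneous polynomials in two variables with vanishing Jacobian determinant have
proportional powers of equal degree. -/
lemma exists_pow_eq_C_mul_pow_of_jacDet_eq_zero {G J : MvPolynomial (Fin 2) ℂ} {g l : ℕ}
    (hG : G.IsHomogeneous g) (hJ : J.IsHomogeneous l) (hG0 : G ≠ 0) (hg : 0 < g)
    (h : jacDet G J = 0) : ∃ c : ℂ, J ^ g = C c * G ^ l := by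
  refine exists_eq_C_mul_of_pderiv_mul_eq (pow_ne_zero _ hG0) fun i => ?_
  have hi := pderiv_mul_eq_of_jacDet_eq_zero hG hJ h i
  rw [pderiv_pow, pderiv_pow]
  obtain ⟨g, rfl⟩ := Nat.exists_eq_succ_of_ne_zero hg.ne'
  rcases l with _ | l <;>
    simp only [Nat.succ_eq_add_one, Nat.cast_zero, zero_mul, mul_zero, Nat.add_sub_cancel,
      pow_succ] at hi ⊢
  · refine mul_left_cancel₀ hG0 ?_
    linear_combination J ^ g * hi
  · linear_combination J ^ g * G ^ l * hi

lemma eq_one_of_sVal_eq_one {R : FractionRing (MvPolynomial (Fin 2) ℂ)} (hR : sVal R = 1)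
    (m : ℕ) (hm : 1 ≤ m) (X : FractionRing (MvPolynomial (Fin 2) ℂ)) (hX : R = X ^ m) :
    m = 1 := by
  rw [sVal] at hR
  have hbdd : BddAbove {m : ℕ | 1 ≤ m ∧ ∃ X : FractionRing (MvPolynomial (Fin 2) ℂ),
      R = X ^ m} := by
    by_contra hb
    rw [Nat.sSup_of_not_bddAbove hb] at hR
    exact zero_ne_one hR
  exact le_antisymm (hR ▸ le_csSup hbdd ⟨hm, X, hX⟩) hm

lemma jacDet_eq_zero_of_eq_zpow {G J : MvPolynomial (Fin 2) ℂ} (hG0 : G ≠ 0) {c : ℂ} {t : ℤ}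
    (h : algebraMap (MvPolynomial (Fin 2) ℂ) (FractionRing (MvPolynomial (Fin 2) ℂ)) J =
      algebraMap (MvPolynomial (Fin 2) ℂ) (FractionRing (MvPolynomial (Fin 2) ℂ)) (C c) *
        algebraMap (MvPolynomial (Fin 2) ℂ) (FractionRing (MvPolynomial (Fin 2) ℂ)) G ^ t) :
    jacDet G J = 0 := by
  have hinj := IsFractionRing.injective (MvPolynomial (Fin 2) ℂ)
    (FractionRing (MvPolynomial (Fin 2) ℂ))
  obtain ⟨n, rfl | rfl⟩ := t.eq_nat_or_neg
  · rw [zpow_natCast, ← map_pow, ← map_mul] at h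
    rw [hinj h, jacDet_mul_right, jacDet_C_right, jacDet_pow_right_self, zero_mul, mul_zero,
      add_zero]
  · rw [zpow_neg, zpow_natCast, ← map_pow, ← div_eq_mul_inv, eq_div_iff
      ((map_ne_zero_iff _ hinj).2 (pow_ne_zero n hG0)), ← map_mul] at h
    have hD := congrArg (jacDet G) (hinj h)
    rw [jacDet_mul_right, jacDet_C_right, jacDet_pow_right_self, mul_zero, add_zero] at hD
    exact (mul_eq_zero.1 hD).resolve_right (pow_ne_zero n hG0)

/-- Let `H, J` be homogeneous with `H` nonconstant, `s = s(H)`, and `G` a simple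
homogeneous polynomial with `G^s = H`. Then `D(H,J) = 0` iff `J = λ·G^t` in the fraction
field, for some `λ ∈ ℂ` and `t ∈ ℤ`. -/
theorem jacDet_eq_zero_iff_zpow (H J G : MvPolynomial (Fin 2) ℂ) (k l : ℕ)
    (hH : H.IsHomogeneous k) (hJ : J.IsHomogeneous l) (hnc : ∀ c : ℂ, H ≠ C c)
    (hGhom : ∃ g : ℕ, G.IsHomogeneous g)
    (hGsimple :
      sVal (algebraMap (MvPolynomial (Fin 2) ℂ) (FractionRing (MvPolynomial (Fin 2) ℂ)) G) = 1)
    (hGs : G ^ (sVal (algebraMap (MvPolynomial (Fin 2) ℂ)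
        (FractionRing (MvPolynomial (Fin 2) ℂ)) H)) = H) :
    jacDet H J = 0 ↔
      ∃ lam : ℂ, ∃ t : ℤ,
        algebraMap (MvPolynomial (Fin 2) ℂ) (FractionRing (MvPolynomial (Fin 2) ℂ)) J =
          algebraMap (MvPolynomial (Fin 2) ℂ) (FractionRing (MvPolynomial (Fin 2) ℂ)) (C lam) *
            (algebraMap (MvPolynomial (Fin 2) ℂ) (FractionRing (MvPolynomial (Fin 2) ℂ)) G) ^ t := by
  have hs : sVal (algebraMap (MvPolynomial (Fin 2) ℂ)
      (FractionRing (MvPolynomial (Fin 2) ℂ)) H) ≠ 0 := fun h => by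
    rw [h, pow_zero] at hGs
    exact hnc 1 (by rw [← hGs, C_1])
  generalize sVal (algebraMap (MvPolynomial (Fin 2) ℂ)
    (FractionRing (MvPolynomial (Fin 2) ℂ)) H) = s at hGs hs
  subst hGs
  have hG0 : G ≠ 0 := by
    rintro rfl
    exact hnc 0 (by rw [zero_pow hs, C_0])
  rw [jacDet_pow_left_eq_zero_iff hG0 hs]
  refine ⟨fun h => ?_, fun ⟨_, _, h⟩ => jacDet_eq_zero_of_eq_zpow hG0 h⟩
  by_cases hJ0 : J = 0
  · exact ⟨0, 0, by simp [hJ0]⟩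
  obtain ⟨g, hg⟩ := hGhom
  have hgpos : 0 < g := by
    refine Nat.pos_of_ne_zero fun h0 => ?_
    subst h0
    have hGC := totalDegree_eq_zero_iff_eq_C.1 (hg.totalDegree hG0)
    exact hnc (coeff 0 G ^ s) (by rw [C_pow, ← hGC])
  obtain ⟨c, hc⟩ := exists_pow_eq_C_mul_pow_of_jacDet_eq_zero hg hJ hG0 hgpos h
  have hinj := IsFractionRing.injective (MvPolynomial (Fin 2) ℂ)
    (FractionRing (MvPolynomial (Fin 2) ℂ))
  have hC (a : ℂ) : algebraMap ℂ (FractionRing (MvPolynomial (Fin 2) ℂ)) a =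
      algebraMap (MvPolynomial (Fin 2) ℂ) (FractionRing (MvPolynomial (Fin 2) ℂ)) (C a) :=
    IsScalarTower.algebraMap_apply ℂ (MvPolynomial (Fin 2) ℂ) _ a
  obtain ⟨e, t, het⟩ := IsAlgClosed.exists_eq_algebraMap_mul_pow (c := c)
    ((map_ne_zero_iff _ hinj).2 hJ0) ((map_ne_zero_iff _ hinj).2 hG0)
    (eq_one_of_sVal_eq_one hGsimple) hgpos
    (by rw [hC, ← map_pow, hc, map_mul, map_pow])
  exact ⟨e, t, by rw [het, hC, zpow_natCast]⟩
end

section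
/- Let P, Q ∈ ℂ[x,y] with P(0) = Q(0) = 0, deg P = k ≥ 1, deg Q = l ≥ 1, and k·l > 1. Suppose the Jacobian determinant D(P,Q) is a constant. Let s = s(P_k) and let G be a simple homogeneous polynomial with G^s = P_k. Then k divides s·l, and there exists λ ∈ ℂ, λ ≠ 0, such that Q_l = λ·G^{s·l/k}. -/
open MvPolynomial

section General

variable {σ R : Type*} [CommSemiring R]

theorem MvPolynomial.homogeneousComponent_pderiv (i : σ) (n : ℕ) (p : MvPolynomial σ R) :
    homogeneousComponent n (pderiv i p) = pderiv i (homogeneousComponent (n + 1) p) := by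
  classical
  ext d
  simp only [coeff_homogeneousComponent, coeff_pderiv, map_add, Finsupp.degree_single,
    add_left_inj]
  split_ifs <;> simp

theorem MvPolynomial.totalDegree_pderiv_le (i : σ) (p : MvPolynomial σ R) :
    (pderiv i p).totalDegree ≤ p.totalDegree - 1 := by
  refine Finset.sup_le fun d hd => ?_
  rw [mem_support_iff, coeff_pderiv] at hd
  have h := le_totalDegree (mem_support_iff.mpr (left_ne_zero_of_mul hd))
  change (d + Finsupp.single i 1).degree ≤ _ at h
  change d.degree ≤ _
  rw [map_add, Finsupp.degree_single] at h
  omega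

theorem MvPolynomial.homogeneousComponent_totalDegree_ne_zero {p : MvPolynomial σ R}
    (hp : p ≠ 0) : homogeneousComponent p.totalDegree p ≠ 0 := by
  obtain ⟨d, hd, hdeg⟩ := Finset.exists_mem_eq_sup p.support (support_nonempty.mpr hp)
    fun d => d.sum fun _ e => e
  intro h
  have hc := congrArg (coeff d) h
  replace hdeg : d.degree = p.totalDegree := hdeg.symm
  rw [coeff_homogeneousComponent, if_pos hdeg, coeff_zero] at hc
  exact mem_support_iff.mp hd hc

theorem MvPolynomial.homogeneousComponent_mul_of_totalDegree_le {p q : MvPolynomial σ R}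
    {m n : ℕ} (hp : p.totalDegree ≤ m) (hq : q.totalDegree ≤ n) :
    homogeneousComponent (m + n) (p * q) =
      homogeneousComponent m p * homogeneousComponent n q := by
  classical
  ext d
  rw [coeff_homogeneousComponent]
  split_ifs with hd
  · rw [coeff_mul, coeff_mul]
    refine Finset.sum_congr rfl fun ⟨a, b⟩ hab => ?_
    replace hab : a + b = d := Finset.HasAntidiagonal.mem_antidiagonal.mp hab
    have hdeg : a.degree + b.degree = m + n := by
      rw [← hd, ← hab, map_add]
    simp only [coeff_homogeneousComponent]
    rcases lt_trichotomy a.degree m with h | h | h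
    · have : coeff b q = 0 := coeff_eq_zero_of_totalDegree_lt (by
        change _ < b.degree
        omega)
      simp [this]
    · rw [if_pos h, if_pos (by omega)]
    · have : coeff a p = 0 := coeff_eq_zero_of_totalDegree_lt (by
        change _ < a.degree
        omega)
      simp [this]
  · exact (((homogeneousComponent_isHomogeneous m p).mul
      (homogeneousComponent_isHomogeneous n q)).coeff_eq_zero hd).symm

theorem MvPolynomial.eq_C_of_pderiv_eq_zero [IsDomain R] [CharZero R] {p : MvPolynomial σ R}
    (h : ∀ i, pderiv i p = 0) : p = C (coeff 0 p) := by
  classical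
  ext d
  rw [coeff_C]
  split_ifs with hd
  · rw [hd]
  · obtain ⟨i, hi⟩ : ∃ i, d i ≠ 0 := by
      by_contra! H
      exact hd (Finsupp.ext H).symm
    have hle : Finsupp.single i 1 ≤ d := by
      rw [Finsupp.single_le_iff]
      omega
    have hc := congrArg (coeff (d - Finsupp.single i 1)) (h i)
    rw [coeff_pderiv, tsub_add_cancel_of_le hle, coeff_zero] at hc
    exact (mul_eq_zero.mp hc).resolve_right (Nat.cast_add_one_ne_zero _)

end General

theorem MvPolynomial.pderiv_eq_zero_of_dvd {σ R : Type*} [CommRing R] [IsDomain R]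
    {p : MvPolynomial σ R} {i : σ} (h : p ∣ pderiv i p) : pderiv i p = 0 := by
  by_contra hne
  obtain ⟨q, hq⟩ := h
  have hpq : p * q ≠ 0 := hq ▸ hne
  have hdeg := totalDegree_mul_of_isDomain (left_ne_zero_of_mul hpq) (right_ne_zero_of_mul hpq)
  have hle := totalDegree_pderiv_le i p
  rw [hq, hdeg] at hle
  have hp0 : p.totalDegree = 0 := by omega
  rw [totalDegree_eq_zero_iff_eq_C] at hp0
  apply hne
  rw [hp0, pderiv_C]

/-- Two polynomials over a field of characteristic zero with the same logarithmic partial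
derivatives are proportional. -/
theorem MvPolynomial.exists_eq_C_mul_of_mul_pderiv_eq {σ K : Type*} [Field K] [CharZero K]
    {p q : MvPolynomial σ K} (hp : p ≠ 0)
    (h : ∀ i, p * pderiv i q = q * pderiv i p) : ∃ c : K, q = C c * p := by
  obtain ⟨a, b, r, hab, rfl, rfl⟩ := UniqueFactorizationMonoid.exists_reduced_factors p hp q
  have hr : r ≠ 0 := left_ne_zero_of_mul hp
  have ha : a ≠ 0 := right_ne_zero_of_mul hp
  have hW (i : σ) : a * pderiv i b = b * pderiv i a := by
    have hi := h i
    rw [pderiv_mul, pderiv_mul] at hi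
    refine mul_left_cancel₀ (mul_ne_zero hr hr) ?_
    linear_combination hi
  have haC := eq_C_of_pderiv_eq_zero fun i =>
    pderiv_eq_zero_of_dvd (hab.dvd_of_dvd_mul_left ⟨_, (hW i).symm⟩)
  have hbC := eq_C_of_pderiv_eq_zero fun i =>
    pderiv_eq_zero_of_dvd (hab.symm.dvd_of_dvd_mul_left ⟨_, hW i⟩)
  have ha0 : coeff 0 a ≠ 0 := fun h0 => ha (by rw [haC, h0, C_0])
  refine ⟨coeff 0 b / coeff 0 a, ?_⟩
  rw [haC, hbC, mul_left_comm, ← C_mul, coeff_zero_C, coeff_zero_C, div_mul_cancel₀ _ ha0]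

theorem homogeneousComponent_jacDet {F G : MvPolynomial (Fin 2) ℂ} {m n : ℕ}
    (hF : F.totalDegree ≤ m + 1) (hG : G.totalDegree ≤ n + 1) :
    homogeneousComponent (m + n) (jacDet F G) =
      jacDet (homogeneousComponent (m + 1) F) (homogeneousComponent (n + 1) G) := by
  have hF' (i : Fin 2) : (pderiv i F).totalDegree ≤ m := by
    have := totalDegree_pderiv_le i F
    omega
  have hG' (i : Fin 2) : (pderiv i G).totalDegree ≤ n := by
    have := totalDegree_pderiv_le i G
    omega
  simp only [jacDet, map_sub, homogeneousComponent_mul_of_totalDegree_le (hF' _) (hG' _),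
    homogeneousComponent_pderiv]

/-- Homogeneous polynomials in two variables with vanishing Jacobian determinant have
proportional logarithmic partial derivatives. -/
theorem mul_pderiv_eq_of_jacDet_eq_zero {F G : MvPolynomial (Fin 2) ℂ} {m n : ℕ}
    (hF : F.IsHomogeneous m) (hG : G.IsHomogeneous n) (h : jacDet F G = 0) (i : Fin 2) :
    (m : MvPolynomial (Fin 2) ℂ) * F * pderiv i G = n * G * pderiv i F := by
  have eF := hF.sum_X_mul_pderiv
  have eG := hG.sum_X_mul_pderiv
  rw [Fin.sum_univ_two, nsmul_eq_mul] at eF eG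
  rw [jacDet] at h
  fin_cases i
  · simp only [Fin.zero_eta]
    linear_combination (-pderiv 0 G) * eF + pderiv 0 F * eG - X 1 * h
  · simp only [Fin.mk_one]
    linear_combination (-pderiv 1 G) * eF + pderiv 1 F * eG + X 0 * h

/-- If `s(R) = 1` then `R` is not an `m`-th power for any `m > 1`; here the power is exhibited
by a relation `Y ^ a = c * R ^ b` with `a`, `b` coprime. -/
theorem eq_one_of_sVal_eq_one_s8 {R Y : FractionRing (MvPolynomial (Fin 2) ℂ)} {c : ℂ} {a b : ℕ}
    (hR : sVal R = 1) (hR0 : R ≠ 0) (hc : c ≠ 0) (ha : 1 ≤ a) (hab : a.Coprime b)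
    (h : Y ^ a = algebraMap (MvPolynomial (Fin 2) ℂ) _ (C c) * R ^ b) : a = 1 := by
  obtain ⟨e, he⟩ := IsAlgClosed.exists_pow_nat_eq c ha
  set φ := algebraMap (MvPolynomial (Fin 2) ℂ) (FractionRing (MvPolynomial (Fin 2) ℂ))
  have hφe : φ (C e) ≠ 0 := by
    rw [Ne, FaithfulSMul.algebraMap_eq_zero_iff, C_eq_zero]
    rintro rfl
    exact hc (by rw [← he, zero_pow (by omega)])
  have hZ : (Y / φ (C e)) ^ a = R ^ b := by
    rw [div_pow, h, ← he, C_pow, map_pow, mul_div_cancel_left₀ _ (pow_ne_zero _ hφe)]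
  have hbez : (a : ℤ) * a.gcdA b + b * a.gcdB b = 1 := by
    rw [← Nat.gcd_eq_gcd_ab, hab.gcd_eq_one, Nat.cast_one]
  have hX : R = (R ^ a.gcdA b * (Y / φ (C e)) ^ a.gcdB b) ^ a := by
    rw [mul_pow, ← zpow_natCast (R ^ _), ← zpow_natCast ((Y / φ (C e)) ^ _), ← zpow_mul,
      ← zpow_mul, mul_comm _ (a : ℤ), mul_comm _ (a : ℤ), zpow_mul (Y / φ (C e)), zpow_natCast,
      hZ, ← zpow_natCast R b, ← zpow_mul, ← zpow_add₀ hR0, hbez, zpow_one]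
  have hbdd : BddAbove {m : ℕ | 1 ≤ m ∧
      ∃ X : FractionRing (MvPolynomial (Fin 2) ℂ), R = X ^ m} := by
    by_contra hb
    rw [sVal, Nat.sSup_of_not_bddAbove hb] at hR
    exact zero_ne_one hR
  have hle := le_csSup hbdd (show a ∈ _ from ⟨ha, _, hX⟩)
  rw [sVal] at hR
  omega

/-- If `P, Q` vanish at the origin, have degrees `k, l ≥ 1` with `k·l > 1`, `D(P,Q)` is
constant, `s = s(P_k)` and `G` is a simple homogeneous polynomial with `G^s = P_k`,
then `k ∣ s·l` and `Q_l = λ·G^{s·l/k}` for some nonzero `λ ∈ ℂ`. -/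
theorem top_component_Q_eq_power_of_G (P Q G : MvPolynomial (Fin 2) ℂ) (k l s : ℕ)
    (hP0 : eval (0 : Fin 2 → ℂ) P = 0) (hQ0 : eval (0 : Fin 2 → ℂ) Q = 0)
    (hdegP : P.totalDegree = k) (hdegQ : Q.totalDegree = l)
    (hk : 1 ≤ k) (hl : 1 ≤ l) (hkl : 1 < k * l)
    (hconst : ∃ c : ℂ, jacDet P Q = C c)
    (hs : s = sVal (algebraMap (MvPolynomial (Fin 2) ℂ)
        (FractionRing (MvPolynomial (Fin 2) ℂ)) (homogeneousComponent k P)))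
    (hGhom : ∃ g : ℕ, G.IsHomogeneous g)
    (hGsimple :
      sVal (algebraMap (MvPolynomial (Fin 2) ℂ) (FractionRing (MvPolynomial (Fin 2) ℂ)) G) = 1)
    (hGs : G ^ s = homogeneousComponent k P) :
    k ∣ s * l ∧
    ∃ lam : ℂ, lam ≠ 0 ∧ homogeneousComponent l Q = C lam * G ^ (s * l / k) := by
  have hH : (homogeneousComponent l Q).IsHomogeneous l := homogeneousComponent_isHomogeneous l Q
  have hF : (homogeneousComponent k P).IsHomogeneous k := homogeneousComponent_isHomogeneous k P
  have hF0 : homogeneousComponent k P ≠ 0 := by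
    rw [← hdegP]
    refine homogeneousComponent_totalDegree_ne_zero fun h0 => ?_
    rw [h0, totalDegree_zero] at hdegP
    omega
  have hH0 : homogeneousComponent l Q ≠ 0 := by
    rw [← hdegQ]
    refine homogeneousComponent_totalDegree_ne_zero fun h0 => ?_
    rw [h0, totalDegree_zero] at hdegQ
    omega
  have hjac : jacDet (homogeneousComponent k P) (homogeneousComponent l Q) = 0 := by
    obtain ⟨c, hc⟩ := hconst
    obtain ⟨m, rfl⟩ := Nat.exists_eq_add_of_le' hk
    obtain ⟨n, rfl⟩ := Nat.exists_eq_add_of_le' hl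
    rw [← homogeneousComponent_jacDet hdegP.le hdegQ.le, hc]
    apply homogeneousComponent_eq_zero
    rw [totalDegree_C]
    by_contra! hmn
    obtain ⟨rfl, rfl⟩ : m = 0 ∧ n = 0 := by omega
    omega
  clear hs
  obtain ⟨g, hg⟩ := hGhom
  generalize homogeneousComponent l Q = H at *
  rw [← hGs] at hjac hF hF0
  have hk_eq : k = g * s := hF.inj_right (hg.pow s) hF0
  obtain ⟨hg1, hs1⟩ : 1 ≤ g ∧ 1 ≤ s := by
    constructor <;> by_contra! h0
    · obtain rfl : g = 0 := by omega
      omega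
    · obtain rfl : s = 0 := by omega
      omega
  have hG0 : G ≠ 0 := fun h0 => hF0 (by rw [h0, zero_pow (by omega)])
  have hjacG : jacDet G H = 0 := by
    have hmul : (s : MvPolynomial (Fin 2) ℂ) * G ^ (s - 1) * jacDet G H = 0 := by
      rw [← hjac, jacDet, jacDet, pderiv_pow, pderiv_pow]
      ring
    exact (mul_eq_zero.mp hmul).resolve_left
      (mul_ne_zero (Nat.cast_ne_zero.mpr (by omega)) (pow_ne_zero _ hG0))
  have hlog := mul_pderiv_eq_of_jacDet_eq_zero hg hH hjacG
  obtain ⟨d, a, b, hd, hab, rfl, rfl⟩ := Nat.exists_coprime' (Nat.gcd_pos_of_pos_left l hg1)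
  have ha : 1 ≤ a := Nat.pos_of_ne_zero (by rintro rfl; omega)
  have hb : 1 ≤ b := Nat.pos_of_ne_zero (by rintro rfl; omega)
  obtain ⟨c, hc⟩ := exists_eq_C_mul_of_mul_pderiv_eq (p := G ^ b) (q := H ^ a)
    (pow_ne_zero _ hG0) (fun i => by
      have hi : (a : MvPolynomial (Fin 2) ℂ) * G * pderiv i H = b * H * pderiv i G := by
        have hd0 : (d : MvPolynomial (Fin 2) ℂ) ≠ 0 := Nat.cast_ne_zero.mpr (by omega)
        refine mul_left_cancel₀ hd0 ?_
        have := hlog i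
        push_cast at this
        linear_combination this
      obtain ⟨a, rfl⟩ := Nat.exists_eq_add_of_le' ha
      obtain ⟨b, rfl⟩ := Nat.exists_eq_add_of_le' hb
      rw [pderiv_pow, pderiv_pow, Nat.add_sub_cancel, Nat.add_sub_cancel]
      linear_combination G ^ b * H ^ a * hi)
  have hc0 : c ≠ 0 := by
    rintro rfl
    exact pow_ne_zero a hH0 (by rw [hc, C_0, zero_mul])
  have ha1 : a = 1 := eq_one_of_sVal_eq_one_s8 hGsimple
    (by rwa [Ne, FaithfulSMul.algebraMap_eq_zero_iff]) hc0 ha hab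
    (Y := algebraMap (MvPolynomial (Fin 2) ℂ) _ H) (by rw [← map_pow, hc, map_mul, map_pow])
  subst ha1
  rw [one_mul] at hk_eq
  have hsl : s * (b * d) = k * b := by rw [hk_eq]; ring
  refine ⟨⟨b, hsl⟩, c, hc0, ?_⟩
  rw [hsl, Nat.mul_div_cancel_left _ (by omega), ← hc, pow_one]
end

section
/- [Statement 2] Let s ≥ 1 be an integer, let j ≥ 1 be an integer, let G ∈ ℂ[x,y] be a nonzero polynomial, let R_1, R_2, R_3, … ∈ ℂ[x,y] be polynomials, let λ_0, …, λ_{j−1} ∈ ℂ, and let t_0, …, t_{j−1} ∈ ℚ be such that s_r := s·t_r is an integer for each r. Then for each variable v ∈ {x, y}, in the fraction field of ℂ[x,y], Σ_{j'=0}^{j−1} Σ_{r=0}^{j'} Σ_{α ∈ Γ, σ(α) = j'−r} λ_r · C(t_r, α) · (t_r − |α|) · G^{s_r − s(|α|+1)} · R^α · (∂R_{j−j'}/∂v) = Σ_{r=0}^{j−1} Σ_{α ∈ Γ, σ(α) = j−r} λ_r · C(t_r, α) · G^{s_r − s|α|} · ∂(R^α)/∂v, where R^α = ∏_{i≥1}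 R_i^{α_i}, integer powers of G are taken in the fraction field, and the formal partial derivatives of the polynomial arguments are mapped into the fraction field. -/
open MvPolynomial

/-- The fraction field of `ℂ[x,y]`. -/
abbrev FF : Type := FractionRing (MvPolynomial (Fin 2) ℂ)

/-- The modulus `|α| = Σ_i α_i`. -/
def msize (a : ℕ+ →₀ ℕ) : ℕ := a.sum fun _ n => n

/-- The size `σ(α) = Σ_i i·α_i`. -/
def ssize (a : ℕ+ →₀ ℕ) : ℕ := a.sum fun i n => (i : ℕ) * n

/-- `α! = Π_i (α_i)!`. -/
def gfact (a : ℕ+ →₀ ℕ) : ℕ := a.prod fun _ n => n.factorial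

/-- The generalized multinomial coefficient `C(t, α) = (t)_{|α|} / α!`, where `(t)_m`
is the falling factorial. -/
noncomputable def mcoeff (t : ℚ) (a : ℕ+ →₀ ℕ) : ℚ :=
  Polynomial.eval t (descPochhammer ℚ (msize a)) / (gfact a : ℚ)

/-- `R^α = Π_{i ≥ 1} R_i^{α_i}`. -/
noncomputable def Rpow (R : ℕ → MvPolynomial (Fin 2) ℂ) (a : ℕ+ →₀ ℕ) :
    MvPolynomial (Fin 2) ℂ :=
  a.prod fun i n => R (i : ℕ) ^ n

theorem msize_add_single (a : ℕ+ →₀ ℕ) (i : ℕ+) :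
    msize (a + Finsupp.single i 1) = msize a + 1 := by
  unfold msize
  rw [Finsupp.sum_add_index' (fun _ => rfl) (fun _ _ _ => rfl), Finsupp.sum_single_index rfl]

theorem ssize_add_single (a : ℕ+ →₀ ℕ) (i : ℕ+) :
    ssize (a + Finsupp.single i 1) = ssize a + i := by
  unfold ssize
  rw [Finsupp.sum_add_index' (fun _ => mul_zero _) (fun _ _ _ => mul_add _ _ _),
    Finsupp.sum_single_index (mul_zero _), mul_one]

theorem Finsupp.sub_add_single_one {ι : Type*} {a : ι →₀ ℕ} {i : ι} (hi : i ∈ a.support) :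
    a - Finsupp.single i 1 + Finsupp.single i 1 = a := by
  apply tsub_add_cancel_of_le
  rw [Finsupp.single_le_iff]
  exact Nat.one_le_iff_ne_zero.2 (Finsupp.mem_support_iff.1 hi)

theorem gfact_add_single (a : ℕ+ →₀ ℕ) (i : ℕ+) :
    gfact (a + Finsupp.single i 1) = (a i + 1) * gfact a := by
  have h : ∀ b : ℕ+ →₀ ℕ, b.support ⊆ insert i a.support →
      gfact b = (b i).factorial * ∏ k ∈ (insert i a.support).erase i, (b k).factorial := by
    intro b hb
    rw [Finset.mul_prod_erase _ (fun k => (b k).factorial) (Finset.mem_insert_self _ _)]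
    exact Finsupp.prod_of_support_subset _ hb _ fun _ _ => rfl
  rw [h a (Finset.subset_insert _ _), h (a + Finsupp.single i 1), ← mul_assoc]
  · congr 1
    · simp [Nat.factorial_succ]
    · refine Finset.prod_congr rfl fun k hk => ?_
      rw [Finsupp.add_apply, Finsupp.single_eq_of_ne (Finset.ne_of_mem_erase hk), add_zero]
  · intro k hk
    rw [Finset.mem_insert, Finsupp.mem_support_iff]
    by_contra! hne
    simp [Finsupp.single_eq_of_ne hne.1, hne.2] at hk

theorem gfact_ne_zero (a : ℕ+ →₀ ℕ) : gfact a ≠ 0 :=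
  Finset.prod_ne_zero_iff.2 fun _ _ => Nat.factorial_ne_zero _

theorem mcoeff_add_single (t : ℚ) (a : ℕ+ →₀ ℕ) (i : ℕ+) :
    mcoeff t (a + Finsupp.single i 1) * ((a i + 1 : ℕ) : ℚ) =
      mcoeff t a * (t - (msize a : ℚ)) := by
  have h := gfact_ne_zero a
  unfold mcoeff
  rw [msize_add_single, gfact_add_single, descPochhammer_succ_eval]
  have h' : ((a i : ℚ) + 1) ≠ 0 := by positivity
  push_cast
  field_simp

theorem setOf_ssize_eq_finite (n : ℕ) : {a : ℕ+ →₀ ℕ | ssize a = n}.Finite := by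
  let e : ℕ+ →₀ ℕ := Finsupp.onFinset ((Finset.range (n + 1)).image Nat.toPNat')
    (fun i => if (i : ℕ) ≤ n then n else 0) (by
      intro i hi
      rw [Finset.mem_image]
      refine ⟨i, ?_, by simp⟩
      rw [Finset.mem_range]
      by_contra h
      exact hi (if_neg (by omega)))
  refine (Set.finite_Iic e).subset fun a ha i => ?_
  change a i ≤ if (i : ℕ) ≤ n then n else 0
  by_cases h0 : a i = 0
  · simp [h0]
  have h : (i : ℕ) * a i ≤ n := by
    rw [← show ssize a = n from ha]
    exact Finset.single_le_sum (f := fun k : ℕ+ => (k : ℕ) * a k) (fun _ _ => Nat.zero_le _)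
      (Finsupp.mem_support_iff.2 h0)
  have hi : (i : ℕ) ≤ n := (Nat.le_mul_of_pos_right _ (Nat.pos_of_ne_zero h0)).trans h
  rw [if_pos hi]
  exact (Nat.le_mul_of_pos_left _ i.pos).trans h

/-- The multi-indices of size `n`. -/
noncomputable def ofSsize (n : ℕ) : Finset (ℕ+ →₀ ℕ) := (setOf_ssize_eq_finite n).toFinset

theorem mem_ofSsize {n : ℕ} {a : ℕ+ →₀ ℕ} : a ∈ ofSsize n ↔ ssize a = n := by
  simp [ofSsize]

theorem finsum_ssize_eq {M : Type*} [AddCommMonoid M] (f : (ℕ+ →₀ ℕ) → M) (n : ℕ) :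
    ∑ᶠ a ∈ {a : ℕ+ →₀ ℕ | ssize a = n}, f a = ∑ a ∈ ofSsize n, f a :=
  finsum_mem_eq_finite_toFinset_sum _ _

theorem Derivation.leibniz_finset_prod {ι A B : Type*} [CommSemiring A] [CommSemiring B]
    [Algebra A B] [DecidableEq ι] (D : Derivation A B B) (s : Finset ι) (f : ι → B) :
    D (∏ i ∈ s, f i) = ∑ i ∈ s, (∏ k ∈ s.erase i, f k) * D (f i) := by
  induction s using Finset.induction_on with
  | empty => simp
  | insert i s hi ih =>
    rw [Finset.prod_insert hi, Finset.sum_insert hi, Derivation.leibniz, ih,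
      Finset.erase_insert hi, add_comm, smul_eq_mul, smul_eq_mul, Finset.mul_sum]
    congr 1
    refine Finset.sum_congr rfl fun k hk => ?_
    have hne : i ≠ k := fun h => hi (h ▸ hk)
    rw [Finset.erase_insert_of_ne hne, Finset.prod_insert fun h => hi (Finset.mem_of_mem_erase h),
      mul_assoc]

theorem pderiv_Rpow (v : Fin 2) (R : ℕ → MvPolynomial (Fin 2) ℂ) (a : ℕ+ →₀ ℕ) :
    pderiv v (Rpow R a) =
      ∑ i ∈ a.support, (a i : MvPolynomial (Fin 2) ℂ) * Rpow R (a - Finsupp.single i 1) *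
        pderiv v (R i) := by
  rw [Rpow, Finsupp.prod, Derivation.leibniz_finset_prod]
  refine Finset.sum_congr rfl fun i hi => ?_
  have h : Rpow R (a - Finsupp.single i 1) =
      R i ^ (a i - 1) * ∏ k ∈ a.support.erase i, R k ^ a k := by
    rw [Rpow, Finsupp.prod_of_support_subset _ (s := a.support) (fun k hk => ?_) _
      (fun _ _ => pow_zero _), ← Finset.mul_prod_erase _ _ hi]
    · congr 1
      · simp
      · refine Finset.prod_congr rfl fun k hk => ?_
        rw [Finsupp.tsub_apply, Finsupp.single_eq_of_ne (Finset.ne_of_mem_erase hk), tsub_zero]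
    · rw [Finsupp.mem_support_iff] at hk ⊢
      rw [Finsupp.tsub_apply] at hk
      omega
  rw [h, Derivation.leibniz_pow, nsmul_eq_mul, smul_eq_mul]
  ring

theorem sum_ofSsize_support {M : Type*} [AddCommMonoid M] (n : ℕ)
    (f : (ℕ+ →₀ ℕ) → ℕ+ → M) :
    ∑ b ∈ ofSsize n, ∑ i ∈ b.support, f (b - Finsupp.single i 1) i =
      ∑ k ∈ Finset.range n, ∑ a ∈ ofSsize k, f a (n - k).toPNat' := by
  rw [Finset.sum_sigma', Finset.sum_sigma']
  refine Finset.sum_bij' (fun p _ => ⟨n - p.2, p.1 - Finsupp.single p.2 1⟩)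
    (fun q _ => ⟨q.2 + Finsupp.single (n - q.1).toPNat' 1, (n - q.1).toPNat'⟩) ?_ ?_ ?_ ?_ ?_
  · rintro ⟨b, i⟩ h
    simp only [Finset.mem_sigma, mem_ofSsize, Finset.mem_range] at h ⊢
    have hs := ssize_add_single (b - Finsupp.single i 1) i
    rw [Finsupp.sub_add_single_one h.2] at hs
    have := i.pos
    omega
  · rintro ⟨k, a⟩ h
    simp only [Finset.mem_sigma, mem_ofSsize, Finset.mem_range] at h ⊢
    refine ⟨?_, by simp⟩
    rw [ssize_add_single, Nat.toPNat'_coe, if_pos (by omega)]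
    omega
  · rintro ⟨b, i⟩ h
    simp only [Finset.mem_sigma, mem_ofSsize] at h
    have hs := ssize_add_single (b - Finsupp.single i 1) i
    rw [Finsupp.sub_add_single_one h.2] at hs
    have hi : (n - (n - (i : ℕ))).toPNat' = i := by
      rw [show n - (n - (i : ℕ)) = i by omega, PNat.coe_toPNat']
    simp only [hi, Finsupp.sub_add_single_one h.2]
  · rintro ⟨k, a⟩ h
    simp only [Finset.mem_sigma, mem_ofSsize, Finset.mem_range] at h
    have hk : n - ((n - k).toPNat' : ℕ) = k := by
      rw [Nat.toPNat'_coe, if_pos (by omega)]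
      omega
    simp only [hk, add_tsub_cancel_right]
  · rintro ⟨b, i⟩ h
    simp only [Finset.mem_sigma, mem_ofSsize] at h
    have hs := ssize_add_single (b - Finsupp.single i 1) i
    rw [Finsupp.sub_add_single_one h.2] at hs
    have hi : (n - (n - (i : ℕ))).toPNat' = i := by
      rw [show n - (n - (i : ℕ)) = i by omega, PNat.coe_toPNat']
    simp only [hi]

theorem sum_range_sum_range_succ {M : Type*} [AddCommMonoid M] (j : ℕ) (F : ℕ → ℕ → M) :
    ∑ k ∈ Finset.range j, ∑ r ∈ Finset.range (k + 1), F k r =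
      ∑ r ∈ Finset.range j, ∑ k ∈ Finset.range (j - r), F (r + k) r := by
  rw [Finset.sum_comm' (t' := Finset.range j) (s' := fun r => Finset.Ico r j)]
  · exact Finset.sum_congr rfl fun r _ => Finset.sum_Ico_eq_sum_range (fun k => F k r) r j
  · intro k r
    simp only [Finset.mem_range, Finset.mem_Ico]
    omega

/-- Statement 2 of the paper: for each variable `v`,
`Σ_{j'=0}^{j-1} Σ_{r=0}^{j'} Σ_{σ(α)=j'-r} λ_r C(t_r,α)(t_r - |α|) G^{s_r - s(|α|+1)} R^α ∂_v R_{j-j'}`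
`= Σ_{r=0}^{j-1} Σ_{σ(α)=j-r} λ_r C(t_r,α) G^{s_r - s|α|} ∂_v (R^α)`
in the fraction field of `ℂ[x,y]`. -/
theorem statement2 (s j : ℕ) (hs : 1 ≤ s) (hj : 1 ≤ j)
    (G : MvPolynomial (Fin 2) ℂ) (hG : G ≠ 0)
    (R : ℕ → MvPolynomial (Fin 2) ℂ)
    (lam : ℕ → ℂ) (t : ℕ → ℚ) (sr : ℕ → ℤ)
    (hsr : ∀ r < j, (sr r : ℚ) = (s : ℚ) * t r) :
    ∀ v : Fin 2,
      ∑ j' ∈ Finset.range j, ∑ r ∈ Finset.range (j' + 1),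
        ∑ᶠ a ∈ {a : ℕ+ →₀ ℕ | ssize a = j' - r},
          algebraMap (MvPolynomial (Fin 2) ℂ) FF (C (lam r)) *
            ((mcoeff (t r) a : ℚ) : FF) *
            ((t r - (msize a : ℚ) : ℚ) : FF) *
            (algebraMap (MvPolynomial (Fin 2) ℂ) FF G) ^
              (sr r - (s : ℤ) * ((msize a : ℤ) + 1)) *
            algebraMap (MvPolynomial (Fin 2) ℂ) FF (Rpow R a) *
            algebraMap (MvPolynomial (Fin 2) ℂ) FF (pderiv v (R (j - j')))
      =
      ∑ r ∈ Finset.range j,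
        ∑ᶠ a ∈ {a : ℕ+ →₀ ℕ | ssize a = j - r},
          algebraMap (MvPolynomial (Fin 2) ℂ) FF (C (lam r)) *
            ((mcoeff (t r) a : ℚ) : FF) *
            (algebraMap (MvPolynomial (Fin 2) ℂ) FF G) ^ (sr r - (s : ℤ) * (msize a : ℤ)) *
            algebraMap (MvPolynomial (Fin 2) ℂ) FF (pderiv v (Rpow R a)) := by
  intro v
  simp only [finsum_ssize_eq]
  rw [sum_range_sum_range_succ]
  refine Finset.sum_congr rfl fun r _ => ?_
  let D : (ℕ+ →₀ ℕ) → ℕ+ → FF := fun a i =>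
    algebraMap (MvPolynomial (Fin 2) ℂ) FF (C (lam r)) *
      ((mcoeff (t r) a : ℚ) : FF) * ((t r - (msize a : ℚ) : ℚ) : FF) *
      (algebraMap (MvPolynomial (Fin 2) ℂ) FF G) ^ (sr r - (s : ℤ) * ((msize a : ℤ) + 1)) *
      algebraMap (MvPolynomial (Fin 2) ℂ) FF (Rpow R a) *
      algebraMap (MvPolynomial (Fin 2) ℂ) FF (pderiv v (R i))
  trans ∑ k ∈ Finset.range (j - r), ∑ a ∈ ofSsize k, D a (j - r - k).toPNat'
  · refine Finset.sum_congr rfl fun k hk => ?_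
    rw [Finset.mem_range] at hk
    rw [Nat.add_sub_cancel_left]
    refine Finset.sum_congr rfl fun a _ => ?_
    simp only [D]
    rw [Nat.toPNat'_coe, if_pos (by omega), Nat.sub_sub]
  rw [← sum_ofSsize_support]
  refine Finset.sum_congr rfl fun b _ => ?_
  rw [pderiv_Rpow, map_sum, Finset.mul_sum]
  refine Finset.sum_congr rfl fun i hi => ?_
  obtain ⟨a, rfl⟩ : ∃ a, b = a + Finsupp.single i 1 := ⟨_, (Finsupp.sub_add_single_one hi).symm⟩
  have h := congrArg (fun q : ℚ => (q : FF)) (mcoeff_add_single (t r) a i)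
  simp only [Rat.cast_mul, Rat.cast_natCast] at h
  simp only [D, add_tsub_cancel_right, msize_add_single, map_mul, map_natCast, Finsupp.add_apply,
    Finsupp.single_eq_same]
  rw [mul_assoc (algebraMap (MvPolynomial (Fin 2) ℂ) FF (C (lam r))), ← h]
  push_cast
  ring
end
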